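/- Let (T,d,ρ,u) be a plane ℝ-tree. Then the relation ≺ defined on T×[0,1] by α ≺ β iff (α ↷ β or α → β) is a total order: it is reflexive, antisymmetric, transitive, and any two elements of T×[0,1] are comparable. -/

import Mathlib

open Set MeasureTheory Filter Metric

/-- The metric segment `[[x,y]]` between `x` and `y`. -/
def geoSeg {T : Type*} [MetricSpace T] (x y : T) : Set T :=
  {z | dist x z + dist z y = dist x y}

/-- `(T,d)` is an `ℝ`-tree: it is geodesic (any two points are joined by a geodesic
segment, which is `geoSeg x y`) and loopless (this segment is the unique arc joining
`x` and `y`). -/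
structure IsRTree (T : Type*) [MetricSpace T] : Prop where
  geodesic : ∀ x y : T, ∃ γ : ℝ → T, γ 0 = x ∧ γ (dist x y) = y ∧
    (∀ s ∈ Icc (0:ℝ) (dist x y), ∀ t ∈ Icc (0:ℝ) (dist x y),
      dist (γ s) (γ t) = |s - t|) ∧
    γ '' Icc (0:ℝ) (dist x y) = geoSeg x y
  loopless : ∀ x y : T, ∀ f : ℝ → T, ContinuousOn f (Icc (0:ℝ) 1) →
    InjOn f (Icc (0:ℝ) 1) → f 0 = x → f 1 = y → f '' Icc (0:ℝ) 1 = geoSeg x y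

/-- The set of connected components of `T \ {x}`. -/
def comps {T : Type*} [MetricSpace T] (x : T) : Set (Set T) :=
  {C | ∃ y, y ≠ x ∧ C = connectedComponentIn ({x}ᶜ) y}

/-- A plane `ℝ`-tree structure on the metric space `T`: `T` is a separable complete
`ℝ`-tree with a root and a balanced angle function `u`.  `cca x y` is the closest
common ancestor of `x` and `y`. -/
structure PlaneRTree (T : Type*) [MetricSpace T] where
  sep : TopologicalSpace.SeparableSpace T
  cpl : CompleteSpace T
  tree : IsRTree T
  root : T
  cca : T → T → T
  cca_mem : ∀ x y : T, cca x y ∈ geoSeg root x ∩ geoSeg root y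
  cca_max : ∀ x y : T, ∀ z ∈ geoSeg root x ∩ geoSeg root y,
    dist root z ≤ dist root (cca x y)
  u : T → T → ℝ
  u_mem : ∀ x y : T, u x y ∈ Icc (0:ℝ) 1
  u_root : ∀ x : T, u x root = 0
  u_self : ∀ x : T, u x x = 0
  u_eq_iff : ∀ x y z : T, y ≠ x → z ≠ x →
    (u x y = u x z ↔ connectedComponentIn ({x}ᶜ) y = connectedComponentIn ({x}ᶜ) z)
  balanced : ∀ x y : T, (comps x).ncard = 2 → u x y = 0 ∨ u x y = 1/2

namespace PlaneRTree

variable {T : Type*} [MetricSpace T]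

open Classical in
/-- The angle `u(x, (y,w))`: it is `u x y` if `x ≠ y`, and `w` if `x = y`. -/
noncomputable def ang (P : PlaneRTree T) (x : T) (β : T × ℝ) : ℝ :=
  if x = β.1 then β.2 else P.u x β.1

/-- `α ↷ β` : `α` is at the left of `β`. -/
def leftOf (P : PlaneRTree T) (α β : T × ℝ) : Prop :=
  P.ang (P.cca α.1 β.1) α < P.ang (P.cca α.1 β.1) β

/-- `α → β` : `β` is in front of `α`. -/
def frontOf (P : PlaneRTree T) (α β : T × ℝ) : Prop :=
  α.1 ∈ geoSeg P.root β.1 ∧ P.ang α.1 β = α.2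

/-- The contour relation `≺` : `α ≺ β` iff `α ↷ β` or `α → β`. -/
def precOf (P : PlaneRTree T) (α β : T × ℝ) : Prop :=
  P.leftOf α β ∨ P.frontOf α β

end PlaneRTree

section Segments

variable {T : Type*} [MetricSpace T]

theorem mem_geoSeg {x y z : T} : z ∈ geoSeg x y ↔ dist x z + dist z y = dist x y :=
  Iff.rfl

theorem geoSeg_comm (x y : T) : geoSeg x y = geoSeg y x := by
  ext z
  rw [mem_geoSeg, mem_geoSeg, dist_comm x z, dist_comm z y, dist_comm x y, add_comm]

theorem left_mem_geoSeg (x y : T) : x ∈ geoSeg x y := by simp [mem_geoSeg]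

theorem right_mem_geoSeg (x y : T) : y ∈ geoSeg x y := by simp [mem_geoSeg]

theorem geoSeg_trans {p x y z : T} (hxy : x ∈ geoSeg p y) (hyz : y ∈ geoSeg p z) :
    x ∈ geoSeg p z := by
  rw [mem_geoSeg] at *
  linarith [dist_triangle x y z, dist_triangle p x z]

theorem mem_geoSeg_of_mem_of_mem {p x y z : T} (hxy : x ∈ geoSeg p y) (hyz : y ∈ geoSeg p z) :
    y ∈ geoSeg x z := by
  rw [mem_geoSeg] at *
  linarith [dist_triangle x y z, dist_triangle p x z]

theorem geoSeg_antisymm {p x y : T} (hxy : x ∈ geoSeg p y) (hyx : y ∈ geoSeg p x) : x = y := by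
  rw [mem_geoSeg] at *
  rw [dist_comm y x] at hyx
  exact dist_le_zero.1 (by linarith)

theorem isClosed_geoSeg (x y : T) : IsClosed (geoSeg x y) :=
  isClosed_eq (by fun_prop) (by fun_prop)

end Segments

namespace IsRTree

variable {T : Type*} [MetricSpace T]

/-- Points of a segment issued from `p` are totally ordered. -/
theorem mem_geoSeg_or_mem_geoSeg (h : IsRTree T) {p a b y : T} (ha : a ∈ geoSeg p y)
    (hb : b ∈ geoSeg p y) : a ∈ geoSeg p b ∨ b ∈ geoSeg p a := by
  obtain ⟨γ, h0, -, hd, him⟩ := h.geodesic p y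
  rw [← him] at ha hb
  obtain ⟨s, hs, rfl⟩ := ha
  obtain ⟨t, ht, rfl⟩ := hb
  have h0mem : (0 : ℝ) ∈ Icc 0 (dist p y) := ⟨le_rfl, dist_nonneg⟩
  rw [mem_geoSeg, mem_geoSeg, ← h0, hd 0 h0mem s hs, hd 0 h0mem t ht, hd s hs t ht, hd t ht s hs]
  simp only [zero_sub, abs_neg, abs_of_nonneg hs.1, abs_of_nonneg ht.1]
  rcases le_total s t with hst | hst
  · left; rw [abs_of_nonpos (by linarith)]; ring
  · right; rw [abs_of_nonpos (by linarith)]; ring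

theorem continuousOn_of_dist_eq {γ : ℝ → T} {s : Set ℝ}
    (hd : ∀ a ∈ s, ∀ b ∈ s, dist (γ a) (γ b) = |a - b|) : ContinuousOn γ s := by
  refine LipschitzOnWith.continuousOn (K := 1) (LipschitzOnWith.of_dist_le_mul ?_)
  intro a ha b hb
  simp [hd a ha b hb, Real.dist_eq]

theorem isCompact_geoSeg (h : IsRTree T) (x y : T) : IsCompact (geoSeg x y) := by
  obtain ⟨γ, -, -, hd, him⟩ := h.geodesic x y
  rw [← him]
  exact isCompact_Icc.image_of_continuousOn (continuousOn_of_dist_eq hd)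

theorem isPreconnected_geoSeg (h : IsRTree T) (x y : T) : IsPreconnected (geoSeg x y) := by
  obtain ⟨γ, -, -, hd, him⟩ := h.geodesic x y
  rw [← him]
  exact isPreconnected_Icc.image _ (continuousOn_of_dist_eq hd)

/-- Two segments meeting only at their common endpoint concatenate to a segment. -/
theorem mem_geoSeg_of_inter_eq (h : IsRTree T) {x c y : T}
    (hc : ∀ w ∈ geoSeg x c, w ∈ geoSeg c y → w = c) : c ∈ geoSeg x y := by
  rcases eq_or_ne x c with rfl | hxc
  · exact left_mem_geoSeg _ _
  obtain ⟨γ, h0, h1, hd, him⟩ := h.geodesic x c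
  obtain ⟨δ, k0, k1, kd, kim⟩ := h.geodesic c y
  have ha : 0 < dist x c := dist_pos.2 hxc
  have hb : 0 ≤ dist c y := dist_nonneg
  generalize dist x c = a at *
  generalize dist c y = b at *
  have haa : a ∈ Icc 0 a := ⟨ha.le, le_rfl⟩
  have h0b : (0 : ℝ) ∈ Icc 0 b := ⟨le_rfl, hb⟩
  set g : ℝ → T := fun s => if s ≤ a then γ s else δ (s - a) with hg
  have hmix : ∀ s ∈ Icc 0 (a + b), ∀ t ∈ Icc 0 (a + b), s ≤ a → a < t →
      dist (g s) (g t) ≤ |s - t| ∧ g s ≠ g t := by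
    intro s hs t ht hsa hta
    have hs' : s ∈ Icc 0 a := ⟨hs.1, hsa⟩
    have ht' : t - a ∈ Icc 0 b := ⟨by linarith, by linarith [ht.2]⟩
    have e1 := hd s hs' a haa
    have e2 := kd 0 h0b (t - a) ht'
    rw [h1, abs_of_nonpos (by linarith)] at e1
    rw [k0, abs_of_nonpos (by linarith)] at e2
    simp only [hg, if_pos hsa, if_neg (not_le.2 hta)]
    constructor
    · rw [abs_of_nonpos (by linarith)]
      linarith [dist_triangle (γ s) c (δ (t - a))]
    · intro heq
      have hw : δ (t - a) = c := hc _ (heq ▸ him ▸ mem_image_of_mem γ hs')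
        (kim ▸ mem_image_of_mem δ ht')
      rw [hw, dist_self] at e2
      linarith
  have hlip : ∀ s ∈ Icc 0 (a + b), ∀ t ∈ Icc 0 (a + b), dist (g s) (g t) ≤ |s - t| := by
    intro s hs t ht
    rcases le_or_gt s a with hsa | hsa <;> rcases le_or_gt t a with hta | hta
    · simp only [hg, if_pos hsa, if_pos hta]
      exact (hd s ⟨hs.1, hsa⟩ t ⟨ht.1, hta⟩).le
    · exact (hmix s hs t ht hsa hta).1
    · rw [dist_comm, abs_sub_comm]
      exact (hmix t ht s hs hta hsa).1
    · simp only [hg, if_neg (not_le.2 hsa), if_neg (not_le.2 hta)]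
      rw [kd (s - a) ⟨by linarith, by linarith [hs.2]⟩ (t - a)
        ⟨by linarith, by linarith [ht.2]⟩, sub_sub_sub_cancel_right]
  have hinj : InjOn g (Icc 0 (a + b)) := by
    intro s hs t ht heq
    rcases le_or_gt s a with hsa | hsa <;> rcases le_or_gt t a with hta | hta
    · simp only [hg, if_pos hsa, if_pos hta] at heq
      have := hd s ⟨hs.1, hsa⟩ t ⟨ht.1, hta⟩
      rw [heq, dist_self] at this
      exact sub_eq_zero.1 (abs_eq_zero.1 this.symm)
    · exact absurd heq (hmix s hs t ht hsa hta).2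
    · exact absurd heq.symm (hmix t ht s hs hta hsa).2
    · simp only [hg, if_neg (not_le.2 hsa), if_neg (not_le.2 hta)] at heq
      have := kd (s - a) ⟨by linarith, by linarith [hs.2]⟩ (t - a)
        ⟨by linarith, by linarith [ht.2]⟩
      rw [heq, dist_self] at this
      linarith [sub_eq_zero.1 (abs_eq_zero.1 this.symm)]
  have hab : 0 < a + b := by linarith
  have hmaps : MapsTo (fun t : ℝ => t * (a + b)) (Icc 0 1) (Icc 0 (a + b)) := fun t ht =>
    ⟨mul_nonneg ht.1 hab.le, mul_le_of_le_one_left hab.le ht.2⟩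
  have hcont : ContinuousOn g (Icc 0 (a + b)) := by
    refine LipschitzOnWith.continuousOn (K := 1) (LipschitzOnWith.of_dist_le_mul ?_)
    intro s hs t ht
    simpa [Real.dist_eq] using hlip s hs t ht
  have hg1 : g (a + b) = y := by
    rcases hb.eq_or_lt with hb0 | hb0
    · simp only [hg, ← hb0, add_zero, le_refl, if_true]
      rw [h1, ← k0, ← k1, ← hb0]
    · simp only [hg, if_neg (not_le.2 (show a < a + b by linarith)), add_sub_cancel_left, k1]
  rw [← h.loopless x y (fun t => g (t * (a + b)))
    (hcont.comp (by fun_prop) hmaps)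
    (hinj.comp (fun s _ t _ hst => mul_right_cancel₀ hab.ne' hst) hmaps)
    (by simp [hg, ha.le, h0]) (by simp only [one_mul, hg1])]
  refine ⟨a / (a + b), ⟨by positivity, (div_le_one hab).2 (by linarith)⟩, ?_⟩
  simp only [div_mul_cancel₀ a hab.ne', hg, le_refl, if_true, h1]

/-- A maximal common point of `[[p,x]]` and `[[p,y]]` lies on `[[x,y]]`. -/
theorem mem_geoSeg_of_forall_dist_le (h : IsRTree T) {p x y c : T} (hcx : c ∈ geoSeg p x)
    (hcy : c ∈ geoSeg p y)
    (hmax : ∀ z ∈ geoSeg p x ∩ geoSeg p y, dist p z ≤ dist p c) : c ∈ geoSeg x y := by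
  refine h.mem_geoSeg_of_inter_eq fun w hwx hwy => ?_
  rw [mem_geoSeg] at hcx hcy hwx hwy
  rw [dist_comm x w, dist_comm w c, dist_comm x c] at hwx
  have hpx : dist p w + dist w x = dist p x :=
    le_antisymm (by linarith [dist_triangle p c w]) (dist_triangle _ _ _)
  have hpy : dist p w + dist w y = dist p y :=
    le_antisymm (by linarith [dist_triangle p c w]) (dist_triangle _ _ _)
  have := hmax w ⟨hpx, hpy⟩
  exact (dist_le_zero.1 (by linarith : dist c w ≤ 0)).symm

/-- Any three points have a median. -/
theorem exists_median (h : IsRTree T) (p x y : T) :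
    ∃ m, m ∈ geoSeg p x ∧ m ∈ geoSeg p y ∧ m ∈ geoSeg x y := by
  obtain ⟨m, hm, hmax⟩ := ((h.isCompact_geoSeg p x).inter_right
    (isClosed_geoSeg p y)).exists_isMaxOn ⟨p, left_mem_geoSeg _ _, left_mem_geoSeg _ _⟩
    (f := fun z => dist p z) (by fun_prop)
  exact ⟨m, hm.1, hm.2, h.mem_geoSeg_of_forall_dist_le hm.1 hm.2 fun z hz => hmax hz⟩

/-- An interior point of a segment separates its endpoints. -/
theorem connectedComponentIn_ne (h : IsRTree T) {x c y : T} (hc : c ∈ geoSeg x y) (hx : x ≠ c)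
    (hy : y ≠ c) : connectedComponentIn ({c}ᶜ) x ≠ connectedComponentIn ({c}ᶜ) y := by
  intro heq
  set S : Set T := {v | c ∈ geoSeg x v} with hS
  have hSc : IsClosed S := isClosed_eq (by fun_prop) (by fun_prop)
  have hSo : IsOpen (S \ {c}) := by
    rw [Metric.isOpen_iff]
    rintro v ⟨hv, hvc⟩
    refine ⟨dist v c, dist_pos.2 hvc, fun w hw => ?_⟩
    rw [mem_ball, dist_comm] at hw
    refine ⟨?_, fun hwc => by rw [mem_singleton_iff.1 hwc] at hw; exact lt_irrefl _ hw⟩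
    obtain ⟨m, hmv, hmw, hvw⟩ := h.exists_median x v w
    rcases h.mem_geoSeg_or_mem_geoSeg hv hmv with hcm | hmc
    · exact geoSeg_trans hcm hmw
    · have hcv := mem_geoSeg_of_mem_of_mem hmc hv
      rw [mem_geoSeg] at hcv hvw
      rw [dist_comm c v, dist_comm m v] at hcv
      linarith [dist_nonneg (x := m) (y := w), dist_nonneg (x := m) (y := c)]
  have hxm : x ∈ connectedComponentIn ({c}ᶜ) x := mem_connectedComponentIn hx
  have hym : y ∈ connectedComponentIn ({c}ᶜ) x := heq ▸ mem_connectedComponentIn hy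
  have hxS : x ∉ S := fun hxS => hx (by
    have : c ∈ geoSeg x x := hxS
    exact geoSeg_antisymm (left_mem_geoSeg x c) this)
  obtain ⟨z, -, hz1, hz2⟩ := isPreconnected_connectedComponentIn (S \ {c}) Sᶜ hSo
    hSc.isOpen_compl (fun v hv => by
      by_cases hvS : v ∈ S
      · exact Or.inl ⟨hvS, connectedComponentIn_subset _ _ hv⟩
      · exact Or.inr hvS) ⟨y, hym, hc, hy⟩ ⟨x, hxm, hxS⟩
  exact hz2 hz1.1

/-- Descendants of a strict descendant of `c` lie in its component of the complement of `c`. -/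
theorem connectedComponentIn_eq (h : IsRTree T) {p c w y : T} (hcw : c ∈ geoSeg p w)
    (hne : w ≠ c) (hwy : w ∈ geoSeg p y) :
    connectedComponentIn ({c}ᶜ) w = connectedComponentIn ({c}ᶜ) y := by
  refine _root_.connectedComponentIn_eq ((h.isPreconnected_geoSeg w y).subset_connectedComponentIn
    (left_mem_geoSeg _ _) ?_ (right_mem_geoSeg _ _))
  rintro z hz rfl
  have := mem_geoSeg_of_mem_of_mem hcw hwy
  rw [geoSeg_comm] at this hz
  exact hne (geoSeg_antisymm this hz)

end IsRTree

namespace PlaneRTree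

variable {T : Type*} [MetricSpace T] (P : PlaneRTree T)

theorem cca_mem_left (x y : T) : P.cca x y ∈ geoSeg P.root x := (P.cca_mem x y).1

theorem cca_mem_right (x y : T) : P.cca x y ∈ geoSeg P.root y := (P.cca_mem x y).2

theorem mem_geoSeg_cca {x y z : T} (hx : z ∈ geoSeg P.root x) (hy : z ∈ geoSeg P.root y) :
    z ∈ geoSeg P.root (P.cca x y) := by
  rcases P.tree.mem_geoSeg_or_mem_geoSeg hx (P.cca_mem_left x y) with h | h
  · exact h
  · have := P.cca_max x y z ⟨hx, hy⟩
    have h' := mem_geoSeg.1 h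
    rw [dist_le_zero.1 (by linarith : dist (P.cca x y) z ≤ 0)]
    exact right_mem_geoSeg _ _

theorem cca_eq_left_iff {x y : T} : P.cca x y = x ↔ x ∈ geoSeg P.root y :=
  ⟨fun h => h ▸ P.cca_mem_right x y, fun h => geoSeg_antisymm (P.cca_mem_left x y)
    (P.mem_geoSeg_cca (right_mem_geoSeg _ _) h)⟩

theorem cca_comm (x y : T) : P.cca x y = P.cca y x :=
  geoSeg_antisymm (P.mem_geoSeg_cca (P.cca_mem_right x y) (P.cca_mem_left x y))
    (P.mem_geoSeg_cca (P.cca_mem_right y x) (P.cca_mem_left y x))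

theorem cca_self (x : T) : P.cca x x = x := P.cca_eq_left_iff.2 (right_mem_geoSeg _ _)

/-- If `x ∧ y` is an ancestor of `y ∧ z` and differs from it, then `x ∧ z = x ∧ y`. -/
theorem cca_eq_of_mem {x y z : T} (h : P.cca x y ∈ geoSeg P.root (P.cca y z))
    (hne : P.cca x y ≠ P.cca y z) : P.cca x z = P.cca x y := by
  have h1 : P.cca x y ∈ geoSeg P.root (P.cca x z) :=
    P.mem_geoSeg_cca (P.cca_mem_left _ _) (geoSeg_trans h (P.cca_mem_right _ _))
  refine geoSeg_antisymm ?_ h1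
  rcases P.tree.mem_geoSeg_or_mem_geoSeg (P.cca_mem_right x z) (P.cca_mem_right y z) with h2 | h2
  · exact P.mem_geoSeg_cca (P.cca_mem_left _ _) (geoSeg_trans h2 (P.cca_mem_left _ _))
  · exact absurd (geoSeg_antisymm h (P.mem_geoSeg_cca (geoSeg_trans h2 (P.cca_mem_left _ _))
      (P.cca_mem_left _ _))) hne

@[simp]
theorem ang_fst (α : T × ℝ) : P.ang α.1 α = α.2 := if_pos rfl

theorem ang_of_ne {c : T} {α : T × ℝ} (h : α.1 ≠ c) : P.ang c α = P.u c α.1 := if_neg h.symm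

/-- Two points with a common ancestor strictly above `c` are seen from `c` at the same angle. -/
theorem ang_eq_ang {c w : T} {α β : T × ℝ} (hcw : c ∈ geoSeg P.root w) (hne : w ≠ c)
    (hα : w ∈ geoSeg P.root α.1) (hβ : w ∈ geoSeg P.root β.1) : P.ang c α = P.ang c β := by
  have key : ∀ y, w ∈ geoSeg P.root y → y ≠ c := by
    rintro y hy rfl
    exact hne (geoSeg_antisymm hy hcw)
  rw [P.ang_of_ne (key _ hα), P.ang_of_ne (key _ hβ),
    P.u_eq_iff _ _ _ (key _ hα) (key _ hβ), ← P.tree.connectedComponentIn_eq hcw hne hα,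
    ← P.tree.connectedComponentIn_eq hcw hne hβ]

theorem cca_eq_or_of_ang_eq {α β : T × ℝ}
    (h : P.ang (P.cca α.1 β.1) α = P.ang (P.cca α.1 β.1) β) :
    P.cca α.1 β.1 = α.1 ∨ P.cca α.1 β.1 = β.1 := by
  by_contra! hne
  rw [P.ang_of_ne hne.1.symm, P.ang_of_ne hne.2.symm,
    P.u_eq_iff _ _ _ hne.1.symm hne.2.symm] at h
  exact P.tree.connectedComponentIn_ne (P.tree.mem_geoSeg_of_forall_dist_le (P.cca_mem_left _ _)
    (P.cca_mem_right _ _) (P.cca_max _ _)) hne.1.symm hne.2.symm h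

theorem precOf_iff {α β : T × ℝ} :
    P.precOf α β ↔ P.ang (P.cca α.1 β.1) α < P.ang (P.cca α.1 β.1) β ∨
      (P.cca α.1 β.1 = α.1 ∧ P.ang (P.cca α.1 β.1) α = P.ang (P.cca α.1 β.1) β) := by
  refine or_congr Iff.rfl ?_
  rw [frontOf, ← P.cca_eq_left_iff]
  refine and_congr_right fun h => ?_
  rw [h, ang_fst, eq_comm]

theorem precOf_refl (α : T × ℝ) : P.precOf α α :=
  P.precOf_iff.2 (Or.inr ⟨P.cca_self _, rfl⟩)

theorem precOf_antisymm {α β : T × ℝ} (h₁ : P.precOf α β) (h₂ : P.precOf β α) : α = β := by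
  rw [precOf_iff] at h₁ h₂
  rw [P.cca_comm β.1 α.1] at h₂
  rcases h₁ with h₁ | ⟨hc₁, h₁⟩ <;> rcases h₂ with h₂ | ⟨hc₂, h₂⟩
  · exact absurd h₂ h₁.not_gt
  · exact absurd h₂.symm h₁.ne
  · exact absurd h₁.symm h₂.ne
  · have hfst : α.1 = β.1 := hc₁.symm.trans hc₂
    refine Prod.ext hfst ?_
    rw [← P.ang_fst α, ← P.ang_fst β, ← hfst, ← hc₁, h₁]

theorem precOf_total (α β : T × ℝ) : P.precOf α β ∨ P.precOf β α := by
  rw [precOf_iff, precOf_iff, P.cca_comm β.1 α.1]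
  rcases lt_trichotomy (P.ang (P.cca α.1 β.1) α) (P.ang (P.cca α.1 β.1) β) with h | h | h
  · exact Or.inl (Or.inl h)
  · exact (P.cca_eq_or_of_ang_eq h).imp (fun hc => Or.inr ⟨hc, h⟩) (fun hc => Or.inr ⟨hc, h.symm⟩)
  · exact Or.inr (Or.inl h)

theorem precOf_trans {α β γ : T × ℝ} (h₁ : P.precOf α β) (h₂ : P.precOf β γ) :
    P.precOf α γ := by
  rw [precOf_iff] at h₁ h₂ ⊢
  by_cases heq : P.cca α.1 β.1 = P.cca β.1 γ.1
  · rw [← heq] at h₂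
    have hle₂ : P.ang (P.cca α.1 β.1) β ≤ P.ang (P.cca α.1 β.1) γ :=
      h₂.elim le_of_lt fun h => h.2.le
    have hmem : P.cca α.1 β.1 ∈ geoSeg P.root (P.cca α.1 γ.1) :=
      P.mem_geoSeg_cca (P.cca_mem_left _ _) (heq ▸ P.cca_mem_right _ _)
    by_cases hc : P.cca α.1 γ.1 = P.cca α.1 β.1
    · rw [hc]
      rcases h₁ with h₁ | ⟨hα, h₁⟩
      · exact Or.inl (h₁.trans_le hle₂)
      · exact (h₁.trans_le hle₂).lt_or_eq.imp id fun h => ⟨hα, h⟩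
    · have hang := P.ang_eq_ang hmem hc (P.cca_mem_left α.1 γ.1) (P.cca_mem_right α.1 γ.1)
      rcases h₁ with h₁ | ⟨hα, -⟩
      · exact absurd hang (h₁.trans_le hle₂).ne
      · rw [hα] at hmem hc
        exact absurd (geoSeg_antisymm (P.cca_mem_left _ _) hmem) hc
  · rcases P.tree.mem_geoSeg_or_mem_geoSeg (P.cca_mem_right α.1 β.1) (P.cca_mem_left β.1 γ.1)
      with h | h
    · rwa [P.cca_eq_of_mem h heq, ← P.ang_eq_ang h (Ne.symm heq) (P.cca_mem_left β.1 γ.1)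
        (P.cca_mem_right β.1 γ.1)]
    · have hc : P.cca α.1 γ.1 = P.cca β.1 γ.1 := by
        rw [P.cca_comm α.1 β.1, P.cca_comm β.1 γ.1] at h heq
        rw [P.cca_comm α.1 γ.1, P.cca_comm β.1 γ.1]
        exact P.cca_eq_of_mem h (Ne.symm heq)
      rw [hc, P.ang_eq_ang h heq (P.cca_mem_left α.1 β.1) (P.cca_mem_right α.1 β.1)]
      refine h₂.imp id ?_
      rintro ⟨hβ, -⟩
      rw [hβ] at h heq
      exact absurd (geoSeg_antisymm (P.cca_mem_right _ _) h) heq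

end PlaneRTree

/-- The relation `≺` (defined by `α ≺ β` iff `α ↷ β` or `α → β`) is a total order
on `T × [0,1]`: reflexive, antisymmetric, transitive, and any two elements are
comparable. -/
theorem contour_order_is_total_order {T : Type*} [MetricSpace T] (P : PlaneRTree T) :
    (∀ α : T × ℝ, α.2 ∈ Icc (0:ℝ) 1 → P.precOf α α) ∧
    (∀ α β : T × ℝ, α.2 ∈ Icc (0:ℝ) 1 → β.2 ∈ Icc (0:ℝ) 1 →
      P.precOf α β → P.precOf β α → α = β) ∧
    (∀ α β γ : T × ℝ, α.2 ∈ Icc (0:ℝ) 1 → β.2 ∈ Icc (0:ℝ) 1 → γ.2 ∈ Icc (0:ℝ) 1 →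
      P.precOf α β → P.precOf β γ → P.precOf α γ) ∧
    (∀ α β : T × ℝ, α.2 ∈ Icc (0:ℝ) 1 → β.2 ∈ Icc (0:ℝ) 1 →
      P.precOf α β ∨ P.precOf β α) := by
  exact ⟨fun α _ => P.precOf_refl α, fun _ _ _ _ => P.precOf_antisymm,
    fun _ _ _ _ _ _ => P.precOf_trans, fun α β _ _ => P.precOf_total α β⟩
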